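/- Let k ∈ ℕ. Suppose given, for each I : Finset (Fin k), a commutative ring A_I, and for each pair of finsets I ⊆ J a ring homomorphism r_{I,J} : A_I → A_J with r_{I,I} = id and r_{J,K} ∘ r_{I,J} = r_{I,K} whenever I ⊆ J ⊆ K. For v : Fin k → ℕ let supp v : Finset (Fin k) be its support {i : v i ≠ 0}, and for I : Finset (Fin k) let v_I : Fin k → ℕ be its indicator vector. On the abelian group L = ⨁_{v : Fin k → ℕ} A_{supp v} (writing the component of α ∈ A_{supp v} as α t^v), define the convolution product on homogeneous elements by (α t^v)·(β t^w) = (r_{supp v, U}(α) · r_{supp w, U}(β)) t^{v+w}, where U = supp (v + w) = supp v ∪ supp w. Then: (1) this product makes L a commutative, associative, unital ring, with unit 1 ∈ A_∅ in degree v = 0; and (2) it is the unique biadditive, commutative, associative, unital product on L such that (i) (α t^{v_I})·(β t^{v_J}) = (r_{I,I∪J}(α) · r_{J,I∪J}(β)) t^{v_I + v_J} for all finsets I, J and α ∈ A_I, β ∈ A_J, and (ii) (α t^{v})·(1_{A_J} t^{v_J}) = α t^{v + v_J} whenever J ⊆ supp v and α ∈ A_{supp v}. -/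

import Mathlib

open DirectSum

namespace LogConvolution

variable {k : ℕ}

/-- The support of a multiplicity vector. -/
def suppF (v : Fin k → ℕ) : Finset (Fin k) := Finset.univ.filter fun i => v i ≠ 0

/-- The indicator (primitive) multiplicity vector of a finset. -/
def indF (I : Finset (Fin k)) : Fin k → ℕ := fun i => if i ∈ I then 1 else 0

lemma suppF_indF (I : Finset (Fin k)) : suppF (indF I) = I := by
  ext i; simp [suppF, indF]

lemma suppF_add (v w : Fin k → ℕ) : suppF (v + w) = suppF v ∪ suppF w := by
  ext i
  simp only [suppF, Finset.mem_filter, Finset.mem_union, Finset.mem_univ, true_and,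
    Pi.add_apply]
  omega

lemma subset_suppF_add_left (v w : Fin k → ℕ) : suppF v ⊆ suppF (v + w) := by
  rw [suppF_add]; exact Finset.subset_union_left

lemma subset_suppF_add_right (v w : Fin k → ℕ) : suppF w ⊆ suppF (v + w) := by
  rw [suppF_add]; exact Finset.subset_union_right

lemma suppF_indF_add (I J : Finset (Fin k)) : suppF (indF I + indF J) = I ∪ J := by
  rw [suppF_add, suppF_indF, suppF_indF]

lemma suppF_add_indF (v : Fin k → ℕ) (J : Finset (Fin k)) (h : J ⊆ suppF v) :
    suppF (v + indF J) = suppF v := by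
  rw [suppF_add, suppF_indF]
  exact Finset.union_eq_left.mpr h

lemma exists_reduce (v : Fin k → ℕ) (h : v ≠ indF (suppF v)) :
    ∃ (v' : Fin k → ℕ) (i : Fin k), i ∈ suppF v' ∧ v = v' + indF {i} := by
  have : ∃ i, v i ≠ indF (suppF v) i := by
    by_contra! hc
    exact h (funext hc)
  obtain ⟨i, hi⟩ := this
  have h2 : 2 ≤ v i := by
    simp only [indF, suppF, Finset.mem_filter, Finset.mem_univ, true_and] at hi
    split_ifs at hi <;> omega
  refine ⟨v - indF {i}, i, ?_, ?_⟩
  · simp [suppF, indF]; omega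
  · ext j
    by_cases hj : j = i
    · subst hj; simp [indF]; omega
    · simp [indF, hj]

lemma vec_induction (P : (Fin k → ℕ) → Prop) (h0 : ∀ I, P (indF I))
    (h1 : ∀ v i, i ∈ suppF v → P v → P (v + indF {i})) (v : Fin k → ℕ) : P v := by
  induction hn : ∑ i, v i using Nat.strong_induction_on generalizing v with
  | _ n ih =>
    by_cases h : v = indF (suppF v)
    · rw [h]; exact h0 _
    · obtain ⟨v', i, hi, rfl⟩ := exists_reduce v h
      refine h1 _ _ hi (ih _ ?_ v' rfl)
      rw [← hn]
      simp [Finset.sum_add_distrib, indF]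

section
variable {A : Finset (Fin k) → Type*} [∀ I, CommRing (A I)]
  (r : ∀ I J : Finset (Fin k), I ⊆ J → A I →+* A J)

/-- The convolution product on homogeneous components. -/
noncomputable def convHom (v w : Fin k → ℕ) :
    A (suppF v) →+ A (suppF w) →+ (⨁ v : Fin k → ℕ, A (suppF v)) :=
  AddMonoidHom.mk' (fun α => AddMonoidHom.mk' (fun β =>
      DirectSum.of (fun u => A (suppF u)) (v + w)
            (r (suppF v) (suppF (v + w)) (subset_suppF_add_left v w) α *
             r (suppF w) (suppF (v + w)) (subset_suppF_add_right v w) β))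
      (fun a b => by simp only [map_add, mul_add]))
    (fun a b => by ext1 x; simp only [map_add, add_mul, AddMonoidHom.mk'_apply, AddMonoidHom.add_apply])

/-- The convolution product. -/
noncomputable def convMul : (⨁ v : Fin k → ℕ, A (suppF v)) →+
    (⨁ v : Fin k → ℕ, A (suppF v)) →+ (⨁ v : Fin k → ℕ, A (suppF v)) :=
  DirectSum.toAddMonoid fun v =>
    (DirectSum.toAddMonoid fun w => (convHom r v w).flip).flip

lemma convMul_of (v w : Fin k → ℕ) (α : A (suppF v)) (β : A (suppF w)) :
    convMul r (DirectSum.of (fun u => A (suppF u)) v α)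
            (DirectSum.of (fun u => A (suppF u)) w β) =
          DirectSum.of (fun u => A (suppF u)) (v + w)
            (r (suppF v) (suppF (v + w)) (subset_suppF_add_left v w) α *
             r (suppF w) (suppF (v + w)) (subset_suppF_add_right v w) β) := by
  simp [convMul, convHom, DirectSum.toAddMonoid_of]

variable (hr_id : ∀ I, r I I (subset_refl I) = RingHom.id (A I))

lemma cast_eq_r (hr_id : ∀ I, r I I (subset_refl I) = RingHom.id (A I))
    (I J : Finset (Fin k)) (h : I = J) (h' : A I = A J) (x : A I) :
    cast h' x = r I J h.subset x := by
  subst h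
  simp [hr_id]

lemma of_eq (hr_id : ∀ I, r I I (subset_refl I) = RingHom.id (A I))
    {v w : Fin k → ℕ} (h : v = w) (α : A (suppF v)) (β : A (suppF w))
    (hab : r (suppF v) (suppF w) (by rw [h]) α = β) :
    DirectSum.of (fun u => A (suppF u)) v α = DirectSum.of (fun u => A (suppF u)) w β := by
  subst h
  simp only [hr_id, RingHom.id_apply] at hab
  rw [hab]

end

/-- Definition 3.4 and Lemma 3.5 of the paper, abstracted: given a functor
`I ↦ A I` from the inclusion poset of subsets of `{1,…,k}` to commutative rings
(the cohomology rings `H*(S̊_I)` with their restriction maps), the convolution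
product `(α t^v)·(β t^w) = (r α · r β) t^{v+w}` makes
`L = ⨁_{v} A (supp v)` a commutative, associative, unital ring with unit
`1 ∈ A ∅` in degree `0`, and it is the unique biadditive, commutative,
associative, unital product satisfying the relations (i) for primitive vectors
and (ii) for multiplication by fundamental classes of substrata. -/
theorem log_cohomology_convolution_ring (k : ℕ) (A : Finset (Fin k) → Type*)
    [∀ I, CommRing (A I)]
    (r : ∀ I J : Finset (Fin k), I ⊆ J → A I →+* A J)
    (hr_id : ∀ I, r I I (subset_refl I) = RingHom.id (A I))
    (hr_comp : ∀ (I J K : Finset (Fin k)) (hIJ : I ⊆ J) (hJK : J ⊆ K) (x : A I),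
      r J K hJK (r I J hIJ x) = r I K (hIJ.trans hJK) x) :
    ∃ mul : (⨁ v : Fin k → ℕ, A (suppF v)) → (⨁ v : Fin k → ℕ, A (suppF v)) →
        (⨁ v : Fin k → ℕ, A (suppF v)),
      -- the product is given by convolution on homogeneous elements
      (∀ (v w : Fin k → ℕ) (α : A (suppF v)) (β : A (suppF w)),
        mul (DirectSum.of (fun u => A (suppF u)) v α)
            (DirectSum.of (fun u => A (suppF u)) w β) =
          DirectSum.of (fun u => A (suppF u)) (v + w)
            (r (suppF v) (suppF (v + w)) (subset_suppF_add_left v w) α *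
             r (suppF w) (suppF (v + w)) (subset_suppF_add_right v w) β)) ∧
      -- (1) it is a commutative, associative, unital (biadditive) ring structure
      (∀ x y z, mul (x + y) z = mul x z + mul y z) ∧
      (∀ x y z, mul x (y + z) = mul x y + mul x z) ∧
      (∀ x y, mul x y = mul y x) ∧
      (∀ x y z, mul (mul x y) z = mul x (mul y z)) ∧
      (∀ x, mul (DirectSum.of (fun u => A (suppF u)) 0 1) x = x) ∧
      -- (2) uniqueness: any other such product satisfying (i) and (ii) agrees
      (∀ mul' : (⨁ v : Fin k → ℕ, A (suppF v)) → (⨁ v : Fin k → ℕ, A (suppF v)) →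
          (⨁ v : Fin k → ℕ, A (suppF v)),
        (∀ x y z, mul' (x + y) z = mul' x z + mul' y z) →
        (∀ x y z, mul' x (y + z) = mul' x y + mul' x z) →
        (∀ x y, mul' x y = mul' y x) →
        (∀ x y z, mul' (mul' x y) z = mul' x (mul' y z)) →
        (∀ x, mul' (DirectSum.of (fun u => A (suppF u)) 0 1) x = x) →
        -- (i): primitive vectors
        (∀ (I J : Finset (Fin k)) (α : A I) (β : A J),
          mul' (DirectSum.of (fun u => A (suppF u)) (indF I)
                  (cast (congrArg A (suppF_indF I).symm) α))
               (DirectSum.of (fun u => A (suppF u)) (indF J)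
                  (cast (congrArg A (suppF_indF J).symm) β)) =
            DirectSum.of (fun u => A (suppF u)) (indF I + indF J)
              (cast (congrArg A (suppF_indF_add I J).symm)
                (r I (I ∪ J) Finset.subset_union_left α *
                 r J (I ∪ J) Finset.subset_union_right β))) →
        -- (ii): multiplication by the unit of a substratum
        (∀ (v : Fin k → ℕ) (J : Finset (Fin k)) (hJ : J ⊆ suppF v) (α : A (suppF v)),
          mul' (DirectSum.of (fun u => A (suppF u)) v α)
               (DirectSum.of (fun u => A (suppF u)) (indF J)
                  (cast (congrArg A (suppF_indF J).symm) (1 : A J))) =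
            DirectSum.of (fun u => A (suppF u)) (v + indF J)
              (cast (congrArg A (suppF_add_indF v J hJ).symm) α)) →
        mul' = mul) := by
  have hadd_l : ∀ x y z, convMul r (x + y) z = convMul r x z + convMul r y z := by
    intro x y z; simp
  have hadd_r : ∀ x y z, convMul r x (y + z) = convMul r x y + convMul r x z := by
    intro x y z; simp
  have hcomm : ∀ x y, convMul r x y = convMul r y x := by
    intro x y
    induction x using DirectSum.induction_on with
    | zero => simp
    | add x x' hx hx' => rw [hadd_l, hadd_r, hx, hx']
    | of v α =>
      induction y using DirectSum.induction_on with
      | zero => simp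
      | add x x' hx hx' => rw [hadd_l, hadd_r, hx, hx']
      | of w β =>
        rw [convMul_of, convMul_of]
        refine of_eq r hr_id (add_comm v w) _ _ ?_
        rw [map_mul, hr_comp, hr_comp, mul_comm]
  have hassoc : ∀ x y z, convMul r (convMul r x y) z = convMul r x (convMul r y z) := by
    intro x y z
    induction x using DirectSum.induction_on with
    | zero => simp
    | add x x' hx hx' => simp only [hadd_l, hx, hx']
    | of v α =>
      induction y using DirectSum.induction_on with
      | zero => simp
      | add x x' hx hx' => simp only [hadd_l, hadd_r, hx, hx']
      | of w β =>
        induction z using DirectSum.induction_on with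
        | zero => simp
        | add x x' hx hx' => simp only [hadd_r, hx, hx']
        | of u γ =>
          simp only [convMul_of]
          refine of_eq r hr_id (add_assoc v w u) _ _ ?_
          simp only [map_mul, hr_comp, mul_assoc]
  have hone : ∀ x, convMul r (DirectSum.of (fun u => A (suppF u)) 0 1) x = x := by
    intro x
    induction x using DirectSum.induction_on with
    | zero => simp
    | add x x' hx hx' => rw [hadd_r, hx, hx']
    | of v α =>
      rw [convMul_of]
      refine of_eq r hr_id (zero_add v) _ _ ?_
      simp only [map_mul, map_one, one_mul, hr_comp, hr_id, RingHom.id_apply]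
  refine ⟨fun x y => convMul r x y, convMul_of r, hadd_l, hadd_r, hcomm, hassoc, hone, ?_⟩
  intro mul' hl' hr' hc' ha' _ hi hii
  have hz' : ∀ y, mul' 0 y = 0 := fun y => by simpa using hl' 0 0 y
  -- right multiplication by the fundamental classes agrees
  have key : ∀ (v : Fin k → ℕ) (J : Finset (Fin k)), J ⊆ suppF v → ∀ α : A (suppF v),
      mul' (DirectSum.of (fun u => A (suppF u)) v α)
        (DirectSum.of (fun u => A (suppF u)) (indF J) 1) =
      DirectSum.of (fun u => A (suppF u)) (v + indF J)
        (r (suppF v) (suppF (v + indF J)) (subset_suppF_add_left _ _) α) := by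
    intro v J hJ α
    have h := hii v J hJ α
    rw [cast_eq_r r hr_id _ _ (suppF_indF J).symm, map_one,
      cast_eq_r r hr_id _ _ (suppF_add_indF v J hJ).symm] at h
    exact h
  have key2 : ∀ (v : Fin k → ℕ) (J : Finset (Fin k)), J ⊆ suppF v → ∀ α : A (suppF v),
      mul' (DirectSum.of (fun u => A (suppF u)) v α)
        (DirectSum.of (fun u => A (suppF u)) (indF J) 1) =
      convMul r (DirectSum.of (fun u => A (suppF u)) v α)
        (DirectSum.of (fun u => A (suppF u)) (indF J) 1) := by
    intro v J hJ α
    rw [key v J hJ, convMul_of, map_one, mul_one]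
  have base : ∀ I J (α : A (suppF (indF I))) (β : A (suppF (indF J))),
      mul' (DirectSum.of (fun u => A (suppF u)) (indF I) α)
        (DirectSum.of (fun u => A (suppF u)) (indF J) β) =
      convMul r (DirectSum.of (fun u => A (suppF u)) (indF I) α)
        (DirectSum.of (fun u => A (suppF u)) (indF J) β) := by
    intro I J α β
    have h := hi I J (r _ _ (suppF_indF I).subset α) (r _ _ (suppF_indF J).subset β)
    rw [cast_eq_r r hr_id _ _ (suppF_indF I).symm, cast_eq_r r hr_id _ _ (suppF_indF J).symm,
      cast_eq_r r hr_id _ _ (suppF_indF_add I J).symm] at h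
    simp only [map_mul, hr_comp, hr_id, RingHom.id_apply] at h
    rw [h, convMul_of]
  -- extension from primitive vectors, homogeneous second factor
  have ext1 : ∀ (w : Fin k → ℕ) (β : A (suppF w)),
      (∀ I (α : A (suppF (indF I))),
        mul' (DirectSum.of (fun u => A (suppF u)) (indF I) α)
          (DirectSum.of (fun u => A (suppF u)) w β) =
        convMul r (DirectSum.of (fun u => A (suppF u)) (indF I) α)
          (DirectSum.of (fun u => A (suppF u)) w β)) →
      ∀ (v : Fin k → ℕ) (α : A (suppF v)),
        mul' (DirectSum.of (fun u => A (suppF u)) v α)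
          (DirectSum.of (fun u => A (suppF u)) w β) =
        convMul r (DirectSum.of (fun u => A (suppF u)) v α)
          (DirectSum.of (fun u => A (suppF u)) w β) := by
    intro w β hb v
    induction v using vec_induction with
    | h0 I => exact hb I
    | h1 v i hiv ih =>
      intro α
      have hJ : {i} ⊆ suppF v := by simpa using hiv
      have hα : DirectSum.of (fun u => A (suppF u)) (v + indF {i}) α =
          mul' (DirectSum.of (fun u => A (suppF u)) v
            (r _ _ (suppF_add_indF v {i} hJ).subset α))
            (DirectSum.of (fun u => A (suppF u)) (indF {i}) 1) := by
        rw [key v {i} hJ, hr_comp, hr_id, RingHom.id_apply]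
      rw [hα, ha', hc' (DirectSum.of (fun u => A (suppF u)) (indF {i}) 1), ← ha', ih,
        key2 v {i} hJ, hassoc, hcomm (DirectSum.of (fun u => A (suppF u)) (indF {i}) 1),
        ← hassoc, convMul_of, key2 _ _ (hJ.trans (subset_suppF_add_left v w))]
  have ext2 : ∀ (v w : Fin k → ℕ) (α : A (suppF v)) (β : A (suppF w)),
        mul' (DirectSum.of (fun u => A (suppF u)) v α)
          (DirectSum.of (fun u => A (suppF u)) w β) =
        convMul r (DirectSum.of (fun u => A (suppF u)) v α)
          (DirectSum.of (fun u => A (suppF u)) w β) := by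
    intro v w α β
    refine ext1 w β (fun I α' => ?_) v α
    rw [hc', hcomm]
    exact ext1 (indF I) α' (fun J β' => base J I β' α') w β
  funext x y
  induction x using DirectSum.induction_on with
  | zero => simp [hz']
  | add x x' hx hx' => rw [hl', hadd_l, hx, hx']
  | of v α =>
    induction y using DirectSum.induction_on with
    | zero => rw [hc', hz', map_zero]
    | add x x' hx hx' => rw [hr', hadd_r, hx, hx']
    | of w β => exact ext2 v w α β

end LogConvolution
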